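/- Let L/F be a quadratic separable field extension with nontrivial F-automorphism σ, and let A be one of the algebras HK(L,σ,η,μ), Kn2(L,σ,η,μ) or Kn3(L,σ,η,μ), with η ≠ 0 and μ ≠ 0. If η ∈ F, then the group of F-algebra automorphisms of A is isomorphic to ℤ/2ℤ; if η ∉ F, then the group of F-algebra automorphisms of A is trivial. -/

import Mathlib

variable {F L : Type*} [Field F] [Field L] [Algebra F L]

/-- Knuth's first multiplication `Kn₁` on `L ⊕ L`:
`(x,y)(u,v) = (xu + η σ(v) σ⁻²(y), vx + y σ(u) + μ σ(v) σ⁻¹(y))`. -/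
def Kn1mul (σ : L ≃ₐ[F] L) (η μ : L) (p q : L × L) : L × L :=
  (p.1 * q.1 + η * σ q.2 * σ⁻¹ (σ⁻¹ p.2),
   q.2 * p.1 + p.2 * σ q.1 + μ * σ q.2 * σ⁻¹ p.2)

/-- Knuth's second multiplication `Kn₂` on `L ⊕ L`:
`(x,y)(u,v) = (xu + η σ⁻¹(v) σ⁻²(y), vx + y σ(u) + μ v σ⁻¹(y))`. -/
def Kn2mul (σ : L ≃ₐ[F] L) (η μ : L) (p q : L × L) : L × L :=
  (p.1 * q.1 + η * σ⁻¹ q.2 * σ⁻¹ (σ⁻¹ p.2),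
   q.2 * p.1 + p.2 * σ q.1 + μ * q.2 * σ⁻¹ p.2)

/-- Knuth's third multiplication `Kn₃` on `L ⊕ L`:
`(x,y)(u,v) = (xu + η σ⁻¹(v) y, vx + y σ(u) + μ v y)`. -/
def Kn3mul (σ : L ≃ₐ[F] L) (η μ : L) (p q : L × L) : L × L :=
  (p.1 * q.1 + η * σ⁻¹ q.2 * p.2,
   q.2 * p.1 + p.2 * σ q.1 + μ * q.2 * p.2)

/-- The Hughes-Kleinfeld multiplication `HK` on `L ⊕ L`:
`(x,y)(u,v) = (xu + η σ(v) y, vx + y σ(u) + μ σ(v) y)`. -/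
def HKmul (σ : L ≃ₐ[F] L) (η μ : L) (p q : L × L) : L × L :=
  (p.1 * q.1 + η * σ q.2 * p.2,
   q.2 * p.1 + p.2 * σ q.1 + μ * σ q.2 * p.2)


/-- The automorphism group (as a subgroup of the group of `F`-linear self-equivalences)
of a not-necessarily-associative algebra given by a multiplication `mul` and unit `one`
on an `F`-vector space `M`. -/
def ntAut (F M : Type*) [Field F] [AddCommGroup M] [Module F M]
    (mul : M → M → M) (one : M) : Subgroup (M ≃ₗ[F] M) where
  carrier := {e | (∀ x y : M, e (mul x y) = mul (e x) (e y)) ∧ e one = one}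
  one_mem' := ⟨fun _ _ => rfl, rfl⟩
  mul_mem' := by
    rintro e f ⟨he, he1⟩ ⟨hf, hf1⟩
    refine ⟨fun x y => ?_, ?_⟩
    · show e (f (mul x y)) = mul (e (f x)) (e (f y))
      rw [hf, he]
    · show e (f one) = one
      rw [hf1, he1]
  inv_mem' := by
    rintro e ⟨he, he1⟩
    refine ⟨fun x y => ?_, ?_⟩
    · apply e.injective
      show e (e.symm (mul x y)) = e (mul (e.symm x) (e.symm y))
      rw [e.apply_symm_apply, he, e.apply_symm_apply, e.apply_symm_apply]
    · apply e.injective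
      show e (e.symm one) = e one
      rw [e.apply_symm_apply, he1]

/-- The common form of the multiplications `HK`, `Kn₂`, `Kn₃` when `σ` has order two. -/
def twistedMul (σ ρ π : L ≃ₐ[F] L) (η μ : L) (p q : L × L) : L × L :=
  (p.1 * q.1 + η * σ q.2 * p.2,
   q.2 * p.1 + p.2 * σ q.1 + μ * ρ q.2 * π p.2)

lemma AlgEquiv.exists_apply_ne {σ : L ≃ₐ[F] L} (hσ : σ ≠ 1) : ∃ s, σ s ≠ s := by
  by_contra! h
  exact hσ (AlgEquiv.ext h)

/-- The automorphism `(x, y) ↦ (σ x, σ y * b)` of `L ⊕ L` induced by an involution `σ` and an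
element `b` of norm one. -/
def diagonalEquiv (σ : L ≃ₐ[F] L) (hσσ : ∀ x, σ (σ x) = x) (b : L) (hb : b * σ b = 1) :
    (L × L) ≃ₗ[F] (L × L) :=
  LinearEquiv.ofInvolutive
    ((σ.toLinearMap ∘ₗ LinearMap.fst F L L).prod
      (LinearMap.mulRight F b ∘ₗ σ.toLinearMap ∘ₗ LinearMap.snd F L L))
    (fun p => by
      refine Prod.ext (hσσ p.1) ?_
      change σ (σ p.2 * b) * b = p.2
      rw [map_mul, hσσ]
      linear_combination p.2 * hb)

lemma diagonalEquiv_apply (σ : L ≃ₐ[F] L) (hσσ : ∀ x, σ (σ x) = x) (b : L) (hb : b * σ b = 1)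
    (x y : L) : diagonalEquiv σ hσσ b hb (x, y) = (σ x, σ y * b) :=
  rfl

section Quadratic

variable [FiniteDimensional F L]

lemma AlgEquiv.nat_card_eq_two_of_finrank_eq_two (hrank : Module.finrank F L = 2)
    {σ : L ≃ₐ[F] L} (hσ : σ ≠ 1) : Nat.card (L ≃ₐ[F] L) = 2 := by
  have hle : Nat.card (L ≃ₐ[F] L) ≤ 2 := by
    rw [Nat.card_eq_fintype_card, ← hrank]
    exact AlgEquiv.card_le
  have hlt : 1 < Nat.card (L ≃ₐ[F] L) :=
    Finite.one_lt_card_iff_nontrivial.mpr ⟨σ, 1, hσ⟩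
  omega

lemma AlgEquiv.eq_one_or_eq_of_finrank_eq_two (hrank : Module.finrank F L = 2)
    {σ : L ≃ₐ[F] L} (hσ : σ ≠ 1) (τ : L ≃ₐ[F] L) : τ = 1 ∨ τ = σ := by
  by_contra! h
  have hcard := AlgEquiv.nat_card_eq_two_of_finrank_eq_two hrank hσ
  exact h.2 ((Nat.card_eq_two_iff' (1 : L ≃ₐ[F] L)).mp hcard |>.unique h.1 hσ)

lemma AlgEquiv.apply_apply_of_finrank_eq_two (hrank : Module.finrank F L = 2)
    {σ : L ≃ₐ[F] L} (hσ : σ ≠ 1) (x : L) : σ (σ x) = x := by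
  rcases AlgEquiv.eq_one_or_eq_of_finrank_eq_two hrank hσ (σ * σ) with h | h
  · exact DFunLike.congr_fun h x
  · exact absurd (mul_eq_left.mp h) hσ

lemma AlgEquiv.mem_range_algebraMap_iff_of_finrank_eq_two (hrank : Module.finrank F L = 2)
    {σ : L ≃ₐ[F] L} (hσ : σ ≠ 1) (x : L) :
    x ∈ Set.range (algebraMap F L) ↔ σ x = x := by
  have : IsGalois F L := IsGalois.of_card_aut_eq_finrank F L
    ((AlgEquiv.nat_card_eq_two_of_finrank_eq_two hrank hσ).trans hrank.symm)
  rw [IsGalois.mem_range_algebraMap_iff_fixed]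
  refine ⟨fun h => h σ, fun h τ => ?_⟩
  rcases AlgEquiv.eq_one_or_eq_of_finrank_eq_two hrank hσ τ with rfl | rfl
  · rfl
  · exact h

/-- An automorphism of a twisted algebra that preserves `L ⊕ 0` restricts there to `1` or `σ`
and acts diagonally. -/
lemma exists_apply_eq_of_mem_ntAut_twistedMul (hrank : Module.finrank F L = 2)
    {σ ρ π : L ≃ₐ[F] L} (hσ : σ ≠ 1) {η μ : L}
    {e : (L × L) ≃ₗ[F] (L × L)} (he : e ∈ ntAut F (L × L) (twistedMul σ ρ π η μ) (1, 0))
    (hnuc : ∀ x, (e (x, 0)).2 = 0) :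
    ∃ τ : L ≃ₐ[F] L, (τ = 1 ∨ τ = σ) ∧ ∃ b : L, b ≠ 0 ∧
      (∀ x y, e (x, y) = (τ x, τ y * b)) ∧ τ η = η * (b * σ b) ∧
      τ μ * b = μ * (ρ b * π b) := by
  obtain ⟨hmul, hone⟩ := he
  let f : L →ₐ[F] L := AlgHom.ofLinearMap
    (LinearMap.fst F L L ∘ₗ e.toLinearMap ∘ₗ LinearMap.inl F L L)
    (by simp [hone])
    (fun x y => by
      have h := congrArg Prod.fst (hmul (x, 0) (y, 0))
      simpa [twistedMul, hnuc] using h)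
  let τ : L ≃ₐ[F] L := AlgEquiv.ofBijective f (Algebra.IsAlgebraic.algHom_bijective f)
  have hτ : ∀ x, e (x, 0) = (τ x, 0) := fun x => Prod.ext rfl (hnuc x)
  have hτ' := AlgEquiv.eq_one_or_eq_of_finrank_eq_two hrank hσ τ
  have hcomm : ∀ x, τ (σ x) = σ (τ x) := fun x => by
    rcases hτ' with h | h <;> simp [h]
  obtain ⟨s, hs⟩ := AlgEquiv.exists_apply_ne hσ
  obtain ⟨a, b, hab⟩ : ∃ a b, e (0, 1) = (a, b) := ⟨_, _, rfl⟩
  have hy : ∀ y, e (0, y) = (τ y * a, τ y * b) := fun y => by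
    have h := hmul (y, 0) (0, 1)
    simpa [twistedMul, hτ, hab, mul_comm] using h
  have ha : a = 0 := by
    have h := congrArg Prod.fst (hmul (0, 1) (s, 0))
    simp only [twistedMul, hτ, hab, map_zero, map_one, mul_zero, zero_mul, one_mul, add_zero,
      zero_add, hy] at h
    have h0 : (τ (σ s) - τ s) * a = 0 := by linear_combination h
    rcases mul_eq_zero.mp h0 with h1 | h1
    · exact absurd (τ.injective (sub_eq_zero.mp h1)) hs
    · exact h1
  subst ha
  have hxy : ∀ x y, e (x, y) = (τ x, τ y * b) := fun x y => by
    have h : ((x, y) : L × L) = (x, 0) + (0, y) := by simp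
    rw [h, map_add, hτ, hy]
    simp
  have hb : b ≠ 0 := by
    rintro rfl
    have h : ((0, 1) : L × L) = 0 := e.injective (by simp [hab])
    simpa using congrArg Prod.snd h
  have h11 := hmul (0, 1) (0, 1)
  simp only [twistedMul, hxy, map_zero, map_one, mul_zero, mul_one, one_mul, add_zero,
    zero_add, Prod.mk.injEq] at h11
  exact ⟨τ, hτ', b, hb, hxy, by linear_combination h11.1, by linear_combination h11.2⟩

/-- The automorphism group of a twisted algebra all of whose automorphisms preserve `L ⊕ 0`. -/
lemma ntAut_twistedMul_of_preserves (hrank : Module.finrank F L = 2)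
    {σ ρ π : L ≃ₐ[F] L} (hσ : σ ≠ 1) {η μ : L}
    (hnuc : ∀ e ∈ ntAut F (L × L) (twistedMul σ ρ π η μ) (1, 0), ∀ x, (e (x, 0)).2 = 0)
    (hone : ∀ c, c ≠ 0 → μ * c = μ * (ρ c * π c) → c = 1)
    {b : L} (hnorm : b * σ b = 1) (hb : σ μ * b = μ * (ρ b * π b))
    (hb_unique : ∀ c, c ≠ 0 → σ μ * c = μ * (ρ c * π c) → c = b) :
    (η ∈ Set.range (algebraMap F L) →
      Nonempty (ntAut F (L × L) (twistedMul σ ρ π η μ) (1, 0) ≃* Multiplicative (ZMod 2))) ∧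
    (η ∉ Set.range (algebraMap F L) →
      ntAut F (L × L) (twistedMul σ ρ π η μ) (1, 0) = ⊥) := by
  have hσσ := AlgEquiv.apply_apply_of_finrank_eq_two hrank hσ
  rw [AlgEquiv.mem_range_algebraMap_iff_of_finrank_eq_two hrank hσ]
  have key : ∀ e ∈ ntAut F (L × L) (twistedMul σ ρ π η μ) (1, 0),
      e = 1 ∨ (σ η = η ∧ e = diagonalEquiv σ hσσ b hnorm) := by
    intro e he
    obtain ⟨τ, rfl | rfl, c, hc, hxy, h1, h2⟩ :=
      exists_apply_eq_of_mem_ntAut_twistedMul hrank hσ he (hnuc e he)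
    · left
      obtain rfl := hone c hc h2
      ext p <;> simp [hxy]
    · right
      obtain rfl := hb_unique c hc h2
      refine ⟨by rw [h1, hnorm, mul_one], LinearEquiv.ext fun p => ?_⟩
      exact hxy p.1 p.2
  constructor
  · intro hfix
    have hcomm : ∀ τ : L ≃ₐ[F] L, ∀ x, σ (τ x) = τ (σ x) := fun τ x => by
      rcases AlgEquiv.eq_one_or_eq_of_finrank_eq_two hrank hσ τ with rfl | rfl <;> rfl
    have hmem : diagonalEquiv σ hσσ b hnorm ∈
        ntAut F (L × L) (twistedMul σ ρ π η μ) (1, 0) := by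
      refine ⟨fun ⟨x, y⟩ ⟨u, v⟩ => ?_, by simp [diagonalEquiv_apply]⟩
      simp only [twistedMul, diagonalEquiv_apply, map_add, map_mul, hσσ, hfix, hcomm ρ, hcomm π,
        Prod.mk.injEq]
      constructor
      · linear_combination (-(η * v * σ y)) * hnorm
      · linear_combination ρ (σ v) * π (σ y) * hb
    have hne : diagonalEquiv σ hσσ b hnorm ≠ 1 := fun h =>
      hσ (AlgEquiv.ext fun x => congrArg Prod.fst (DFunLike.congr_fun h (x, 0)))
    have hcard : Nat.card (ntAut F (L × L) (twistedMul σ ρ π η μ) (1, 0)) = 2 := by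
      rw [Nat.card_eq_two_iff' 1]
      refine ⟨⟨_, hmem⟩, fun h => hne (congrArg Subtype.val h), fun e he => Subtype.ext ?_⟩
      rcases key e.1 e.2 with h | h
      · exact absurd (Subtype.ext h) he
      · exact h.2
    have : Fact (Nat.Prime 2) := ⟨Nat.prime_two⟩
    exact ⟨mulEquivOfPrimeCardEq (p := 2) hcard (by simp)⟩
  · intro hfix
    rw [Subgroup.eq_bot_iff_forall]
    intro e he
    exact (key e he).resolve_right fun h => hfix h.1

end Quadratic

section Nuclei

variable {σ : L ≃ₐ[F] L} {η μ : L}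

/-- If `L ⊕ 0` lies in the left nucleus and the left nucleus lies in `L ⊕ 0`, then automorphisms
preserve `L ⊕ 0`. -/
lemma ntAut_snd_apply_eq_zero_of_left_nucleus {mul : L × L → L × L → L × L} {one : L × L}
    (hL : ∀ x p q, mul (mul (x, 0) p) q = mul (x, 0) (mul p q))
    (hN : ∀ n, (∀ p q, mul (mul n p) q = mul n (mul p q)) → n.2 = 0)
    (e : (L × L) ≃ₗ[F] (L × L)) (he : e ∈ ntAut F (L × L) mul one) (x : L) :
    (e (x, 0)).2 = 0 := by
  refine hN _ fun p q => ?_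
  obtain ⟨p, rfl⟩ := e.surjective p
  obtain ⟨q, rfl⟩ := e.surjective q
  simp only [← he.1, hL]

/-- If `L ⊕ 0` lies in the right nucleus and the right nucleus lies in `L ⊕ 0`, then automorphisms
preserve `L ⊕ 0`. -/
lemma ntAut_snd_apply_eq_zero_of_right_nucleus {mul : L × L → L × L → L × L} {one : L × L}
    (hL : ∀ x p q, mul (mul p q) (x, 0) = mul p (mul q (x, 0)))
    (hN : ∀ n, (∀ p q, mul (mul p q) n = mul p (mul q n)) → n.2 = 0)
    (e : (L × L) ≃ₗ[F] (L × L)) (he : e ∈ ntAut F (L × L) mul one) (x : L) :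
    (e (x, 0)).2 = 0 := by
  refine hN _ fun p q => ?_
  obtain ⟨p, rfl⟩ := e.surjective p
  obtain ⟨q, rfl⟩ := e.surjective q
  simp only [← he.1, hL]

lemma eq_zero_of_mul_mul_apply_eq {s d : L} (hμ : μ ≠ 0) (hs : σ s ≠ s)
    (h : μ * d * σ s = μ * d * s) : d = 0 := by
  by_contra hd
  exact hs (mul_left_cancel₀ (mul_ne_zero hμ hd) h)

lemma snd_apply_eq_zero_of_mem_ntAut_HK (hσσ : ∀ x, σ (σ x) = x) (hσ : σ ≠ 1) (hμ : μ ≠ 0)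
    (e : (L × L) ≃ₗ[F] (L × L)) (he : e ∈ ntAut F (L × L) (twistedMul σ σ 1 η μ) (1, 0))
    (x : L) : (e (x, 0)).2 = 0 := by
  refine ntAut_snd_apply_eq_zero_of_left_nucleus (fun x p q => ?_) (fun n hn => ?_) e he x
  · ext <;> simp [twistedMul] <;> ring
  · obtain ⟨s, hs⟩ := AlgEquiv.exists_apply_ne hσ
    have h := congrArg Prod.snd (hn (0, 1) (s, 0))
    simp [twistedMul, hσσ] at h
    exact eq_zero_of_mul_mul_apply_eq hμ hs (by linear_combination h)

lemma snd_apply_eq_zero_of_mem_ntAut_Kn2 (hσσ : ∀ x, σ (σ x) = x) (hσ : σ ≠ 1) (hμ : μ ≠ 0)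
    (e : (L × L) ≃ₗ[F] (L × L)) (he : e ∈ ntAut F (L × L) (twistedMul σ 1 σ η μ) (1, 0))
    (x : L) : (e (x, 0)).2 = 0 := by
  refine ntAut_snd_apply_eq_zero_of_right_nucleus (fun x p q => ?_) (fun n hn => ?_) e he x
  · ext <;> simp [twistedMul, hσσ] <;> ring
  · obtain ⟨s, hs⟩ := AlgEquiv.exists_apply_ne hσ
    have h := congrArg Prod.snd (hn (s, 0) (0, 1))
    simp [twistedMul] at h
    exact eq_zero_of_mul_mul_apply_eq hμ hs (by linear_combination h)

lemma snd_apply_eq_zero_of_mem_ntAut_Kn3 (hσ : σ ≠ 1) (hμ : μ ≠ 0)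
    (e : (L × L) ≃ₗ[F] (L × L)) (he : e ∈ ntAut F (L × L) (twistedMul σ 1 1 η μ) (1, 0))
    (x : L) : (e (x, 0)).2 = 0 := by
  refine ntAut_snd_apply_eq_zero_of_left_nucleus (fun x p q => ?_) (fun n hn => ?_) e he x
  · ext <;> simp [twistedMul] <;> ring
  · obtain ⟨s, hs⟩ := AlgEquiv.exists_apply_ne hσ
    have h := congrArg Prod.snd (hn (s, 0) (0, 1))
    simp [twistedMul] at h
    exact eq_zero_of_mul_mul_apply_eq hμ hs (by linear_combination h)

end Nuclei

/-- let `L/F` be a quadratic separable extension with nontrivial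
`F`-automorphism `σ`, and let `A` be one of `HK(L,σ,η,μ)`, `Kn₂(L,σ,η,μ)`,
`Kn₃(L,σ,η,μ)` with `η ≠ 0` and `μ ≠ 0`.  If `η ∈ F` then `Aut(A) ≅ ℤ/2ℤ`;
if `η ∉ F` then `Aut(A)` is trivial. -/
theorem hk_kn2_kn3_aut_quadratic
    [FiniteDimensional F L] [Algebra.IsSeparable F L]
    (hrank : Module.finrank F L = 2)
    (σ : L ≃ₐ[F] L) (hσ : σ ≠ 1) (η μ : L) (hη : η ≠ 0) (hμ : μ ≠ 0) :
    (η ∈ Set.range (algebraMap F L) →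
      Nonempty (↥(ntAut F (L × L) (HKmul σ η μ) ((1 : L), (0 : L))) ≃*
          Multiplicative (ZMod 2)) ∧
      Nonempty (↥(ntAut F (L × L) (Kn2mul σ η μ) ((1 : L), (0 : L))) ≃*
          Multiplicative (ZMod 2)) ∧
      Nonempty (↥(ntAut F (L × L) (Kn3mul σ η μ) ((1 : L), (0 : L))) ≃*
          Multiplicative (ZMod 2))) ∧
    (η ∉ Set.range (algebraMap F L) →
      ntAut F (L × L) (HKmul σ η μ) ((1 : L), (0 : L)) = ⊥ ∧
      ntAut F (L × L) (Kn2mul σ η μ) ((1 : L), (0 : L)) = ⊥ ∧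
      ntAut F (L × L) (Kn3mul σ η μ) ((1 : L), (0 : L)) = ⊥) := by
  have hσσ := AlgEquiv.apply_apply_of_finrank_eq_two hrank hσ
  have hinv : σ⁻¹ = σ := inv_eq_of_mul_eq_one_left (AlgEquiv.ext hσσ)
  have hKn2 : Kn2mul σ η μ = twistedMul σ 1 σ η μ := by
    funext p q
    simp [Kn2mul, twistedMul, hinv, hσσ]
  have hKn3 : Kn3mul σ η μ = twistedMul σ 1 1 η μ := by
    funext p q
    simp [Kn3mul, twistedMul, hinv]
  have hHK : HKmul σ η μ = twistedMul σ σ 1 η μ := rfl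
  have hσμ : σ μ ≠ 0 := by simpa using hμ
  have hone_norm : ∀ c, c ≠ 0 → μ * c = μ * (c * σ c) → c = 1 := fun c hc h => by
    have h1 : σ c = 1 := by
      rw [← mul_right_inj' (mul_ne_zero hμ hc)]
      linear_combination -h
    simpa using h1
  have hunique_norm : ∀ c, c ≠ 0 → σ μ * c = μ * (c * σ c) → c = μ / σ μ := fun c hc h => by
    have h1 : σ c = σ μ / μ := by
      rw [eq_div_iff hμ, ← mul_right_inj' hc]
      linear_combination -h
    simpa [hσσ] using congrArg σ h1
  have hnorm : μ / σ μ * σ (μ / σ μ) = 1 := by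
    rw [map_div₀, hσσ]
    field_simp
  have hb : σ μ * (μ / σ μ) = μ * (μ / σ μ * σ (μ / σ μ)) := by
    rw [hnorm]
    field_simp
  have HK := ntAut_twistedMul_of_preserves hrank hσ
    (snd_apply_eq_zero_of_mem_ntAut_HK (η := η) hσσ hσ hμ)
    (fun c hc h => hone_norm c hc (h.trans (by rw [mul_comm (σ c)]; rfl)))
    hnorm (hb.trans (by rw [mul_comm (μ / σ μ)]; rfl))
    (fun c hc h => hunique_norm c hc (h.trans (by rw [mul_comm (σ c)]; rfl)))
  have Kn2 := ntAut_twistedMul_of_preserves hrank hσ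
    (snd_apply_eq_zero_of_mem_ntAut_Kn2 (η := η) hσσ hσ hμ) hone_norm hnorm hb hunique_norm
  have Kn3 := ntAut_twistedMul_of_preserves hrank hσ
    (snd_apply_eq_zero_of_mem_ntAut_Kn3 (η := η) hσ hμ) (b := σ μ / μ)
    (fun c hc h => by
      rw [← mul_right_inj' (mul_ne_zero hμ hc)]
      simp only [AlgEquiv.one_apply] at h
      linear_combination -h)
    (by rw [map_div₀, hσσ]; field_simp)
    (by simp only [AlgEquiv.one_apply]; field_simp)
    (fun c hc h => by
      rw [eq_div_iff hμ, ← mul_right_inj' hc]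
      simp only [AlgEquiv.one_apply] at h
      linear_combination -h)
  rw [hHK, hKn2, hKn3]
  exact ⟨fun h => ⟨HK.1 h, Kn2.1 h, Kn3.1 h⟩, fun h => ⟨HK.2 h, Kn2.2 h, Kn3.2 h⟩⟩
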